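/- Let α = K/n and suppose 0 ≤ β < (p−α)/p and δ > 0. Then for every state x ∈ {0,...,n} with x ≤ nβ and every t ≥ 0, P[X_{t+1} > x + (n−x)(p−δ) − nα | X_t = x] ≥ 1 − exp(−2n(1−β)δ²). -/

import Mathlib

/-- The probability mass function of a `Binomial(m, p)` random variable at `k`. -/
noncomputable def binomPMF (m : ℕ) (p : ℝ) (k : ℕ) : ℝ :=
  (m.choose k : ℝ) * p ^ k * (1 - p) ^ (m - k)

/-- One-step transition probability of the error Markov chain on `{0, ..., n}`:
from state `x`, draw `Y ~ Binomial(n − x, p)` and move to `x + Y − min (x + Y) K`. -/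
noncomputable def stepProb (n K : ℕ) (p : ℝ) (x y : ℕ) : ℝ :=
  ∑ yv ∈ Finset.range (n - x + 1),
    if x + yv - min (x + yv) K = y then binomPMF (n - x) p yv else 0

/-- `m`-step transition probability of the error Markov chain. -/
noncomputable def iterProb (n K : ℕ) (p : ℝ) : ℕ → ℕ → ℕ → ℝ
  | 0 => fun x y => if x = y then 1 else 0
  | (m + 1) => fun x y =>
      ∑ z ∈ Finset.range (n + 1), stepProb n K p x z * iterProb n K p m z y

open MeasureTheory ProbabilityTheory in
/-- Hoeffding's lemma for a Bernoulli variable. -/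
theorem bernoulli_hoeffding (p s : ℝ) (hp0 : 0 < p) (hp1 : p < 1) :
    1 - p + p * Real.exp (-s) ≤ Real.exp (-(s * p) + s ^ 2 / 8) := by
  set μ : Measure ℝ := ENNReal.ofReal p • Measure.dirac 1 + ENNReal.ofReal (1 - p) • Measure.dirac 0
    with hμ
  have hprob : IsProbabilityMeasure μ := by
    constructor
    rw [hμ]
    simp only [Measure.coe_add, Measure.coe_smul, Pi.add_apply, Pi.smul_apply, measure_univ,
      smul_eq_mul, mul_one]
    rw [← ENNReal.ofReal_add hp0.le (by linarith)]
    simp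
  have hint : ∀ f : ℝ → ℝ, ∫ z, f z ∂μ = p * f 1 + (1 - p) * f 0 := by
    intro f
    have h1 : Integrable f (ENNReal.ofReal p • Measure.dirac (1 : ℝ)) :=
      (integrable_dirac (by simp)).smul_measure (by simp)
    have h0 : Integrable f (ENNReal.ofReal (1 - p) • Measure.dirac (0 : ℝ)) :=
      (integrable_dirac (by simp)).smul_measure (by simp)
    rw [hμ, integral_add_measure h1 h0, integral_smul_measure, integral_smul_measure,
      integral_dirac, integral_dirac, ENNReal.toReal_ofReal hp0.le,
      ENNReal.toReal_ofReal (by linarith)]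
    simp
  have hmem : ∀ᵐ z ∂μ, (fun z : ℝ => z) z ∈ Set.Icc (0 : ℝ) 1 := by
    rw [hμ, ae_add_measure_iff]
    constructor
    · apply Measure.ae_smul_measure
      rw [ae_dirac_eq]; simp
    · apply Measure.ae_smul_measure
      rw [ae_dirac_eq]; simp
  have h := (hasSubgaussianMGF_of_mem_Icc (μ := μ) (X := fun z : ℝ => z)
    measurable_id.aemeasurable hmem).mgf_le (-s)
  rw [mgf, hint, hint] at h
  have e1 : Real.exp (-s * (1 - (p * 1 + (1 - p) * 0))) = Real.exp (-s) * Real.exp (s * p) := by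
    rw [← Real.exp_add]; congr 1; ring
  have e2 : Real.exp (-s * (0 - (p * 1 + (1 - p) * 0))) = Real.exp (s * p) := by
    congr 1; ring
  rw [e1, e2] at h
  have e3 : Real.exp (-(s * p) + s ^ 2 / 8) = Real.exp (-(s*p)) * Real.exp (s ^ 2 / 8) :=
    Real.exp_add _ _
  have e4 : Real.exp (-(s*p)) * Real.exp (s * p) = 1 := by
    rw [← Real.exp_add]; simp
  rw [e3]
  have e5 : (p * (Real.exp (-s) * Real.exp (s * p)) + (1 - p) * Real.exp (s * p))
      ≤ Real.exp (s ^ 2 / 8) := by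
    refine h.trans (le_of_eq ?_)
    congr 1
    simp
    ring
  calc 1 - p + p * Real.exp (-s)
      = (Real.exp (-(s*p)) * Real.exp (s * p)) * (1 - p + p * Real.exp (-s)) := by rw [e4, one_mul]
    _ = Real.exp (-(s*p)) *
        (p * (Real.exp (-s) * Real.exp (s * p)) + (1 - p) * Real.exp (s * p)) := by ring
    _ ≤ _ := mul_le_mul_of_nonneg_left e5 (Real.exp_pos _).le

theorem binomPMF_nonneg (m : ℕ) (p : ℝ) (hp0 : 0 < p) (hp1 : p < 1) (k : ℕ) :
    0 ≤ binomPMF m p k := by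
  have : 0 ≤ 1 - p := by linarith
  unfold binomPMF; positivity

theorem binomPMF_gen (m : ℕ) (p r : ℝ) :
    ∑ k ∈ Finset.range (m + 1), binomPMF m p k * r ^ k = (p * r + (1 - p)) ^ m := by
  rw [add_pow]
  refine Finset.sum_congr rfl fun k _ => ?_
  unfold binomPMF
  rw [mul_pow]; ring

/-- Lower tail Hoeffding bound. -/
theorem binom_lower_tail (m : ℕ) (p δ : ℝ) (hp0 : 0 < p) (hp1 : p < 1) (hδ : 0 < δ) :
    1 - Real.exp (-2 * m * δ ^ 2) ≤ ∑ k ∈ Finset.range (m + 1),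
      if (m : ℝ) * (p - δ) < k then binomPMF m p k else 0 := by
  have h1 := binomPMF_gen m p 1
  have hs := binomPMF_gen m p (Real.exp (-(4 * δ)))
  have hpt : ∀ k ∈ Finset.range (m + 1), binomPMF m p k * 1 ^ k -
      Real.exp (4 * δ * (m * (p - δ))) * (binomPMF m p k * Real.exp (-(4 * δ)) ^ k) ≤
      if (m : ℝ) * (p - δ) < k then binomPMF m p k else 0 := by
    intro k _
    have hb := binomPMF_nonneg m p hp0 hp1 k
    have e : Real.exp (4 * δ * (m * (p - δ))) * (binomPMF m p k * Real.exp (-(4 * δ)) ^ k)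
        = binomPMF m p k * Real.exp (4 * δ * (m * (p - δ) - k)) := by
      rw [← Real.exp_nat_mul, mul_left_comm, ← Real.exp_add]
      congr 2; ring
    rw [e, one_pow, mul_one]
    split_ifs with h
    · have := mul_nonneg hb (Real.exp_pos (4 * δ * (m * (p - δ) - k))).le
      linarith
    · have h2 : 1 ≤ Real.exp (4 * δ * (m * (p - δ) - k)) := by
        apply Real.one_le_exp
        have : 0 ≤ m * (p - δ) - k := by linarith
        positivity
      nlinarith
  have hsum := Finset.sum_le_sum hpt
  rw [Finset.sum_sub_distrib, ← Finset.mul_sum, h1, hs] at hsum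
  refine le_trans ?_ hsum
  have h3 : (p * Real.exp (-(4 * δ)) + (1 - p)) ^ m ≤
      Real.exp (-(4 * δ * p) + (4 * δ) ^ 2 / 8) ^ m := by
    have := bernoulli_hoeffding p (4 * δ) hp0 hp1
    have h0 : 0 ≤ 1 - p := by linarith
    apply pow_le_pow_left₀ (by positivity)
    linarith
  have h4 := mul_le_mul_of_nonneg_left h3 (Real.exp_pos (4 * δ * (m * (p - δ)))).le
  rw [← Real.exp_nat_mul, ← Real.exp_add] at h4
  have h5 : 4 * δ * (m * (p - δ)) + m * (-(4 * δ * p) + (4 * δ) ^ 2 / 8) = -2 * m * δ ^ 2 := by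
    ring
  rw [h5] at h4
  have h6 : (p * 1 + (1 - p)) ^ m = 1 := by simp
  linarith

/-- With `α = K / n`, for `0 ≤ β < (p − α)/p`, `δ > 0` and a state `x ≤ nβ`, the chain
satisfies `P[X_{t+1} > x + (n − x)(p − δ) − nα ∣ X_t = x] ≥ 1 − exp(−2n(1−β)δ²)`
(the chain is time-homogeneous, so this probability does not depend on `t`). -/
theorem one_step_growth_whp (n K : ℕ) (hn : 0 < n) (p : ℝ) (hp0 : 0 < p) (hp1 : p < 1)
    (hK : K ≤ n) (β δ : ℝ) (hβ0 : 0 ≤ β) (hβ : β < (p - (K : ℝ) / n) / p) (hδ : 0 < δ)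
    (x : ℕ) (hxn : x ≤ n) (hx : (x : ℝ) ≤ n * β) :
    1 - Real.exp (-2 * n * (1 - β) * δ ^ 2) ≤
      ∑ y ∈ Finset.range (n + 1),
        if (x : ℝ) + ((n : ℝ) - (x : ℝ)) * (p - δ) - (n : ℝ) * ((K : ℝ) / n) < (y : ℝ)
        then stepProb n K p x y else 0 := by
  have hn' : (n : ℝ) ≠ 0 := by positivity
  rw [mul_div_cancel₀ _ hn']
  have hm : ((n - x : ℕ) : ℝ) = (n : ℝ) - x := by push_cast [hxn]; ring
  have hA : 1 - Real.exp (-2 * n * (1 - β) * δ ^ 2) ≤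
      1 - Real.exp (-2 * (n - x : ℕ) * δ ^ 2) := by
    rw [hm]
    have : -2 * ((n : ℝ) - x) * δ ^ 2 ≤ -2 * n * (1 - β) * δ ^ 2 := by
      have := mul_nonneg (sub_nonneg.2 hx) (sq_nonneg δ)
      nlinarith
    have := Real.exp_le_exp.2 this
    linarith
  refine (hA.trans (binom_lower_tail (n - x) p δ hp0 hp1 hδ)).trans ?_
  have hsw : (∑ y ∈ Finset.range (n + 1),
        if (x : ℝ) + ((n : ℝ) - (x : ℝ)) * (p - δ) - (K : ℝ) < (y : ℝ)
        then stepProb n K p x y else 0) =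
      ∑ k ∈ Finset.range (n - x + 1), ∑ y ∈ Finset.range (n + 1),
        if x + k - min (x + k) K = y then
          (if (x : ℝ) + ((n : ℝ) - (x : ℝ)) * (p - δ) - (K : ℝ) < (y : ℝ)
            then binomPMF (n - x) p k else 0) else 0 := by
    rw [Finset.sum_comm]
    refine Finset.sum_congr rfl fun y _ => ?_
    unfold stepProb
    split_ifs with h
    · rfl
    · simp
  rw [hsw]
  refine Finset.sum_le_sum fun k hk => ?_
  rw [Finset.mem_range] at hk
  rw [Finset.sum_ite_eq, if_pos (Finset.mem_range.2 (by omega)), hm]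
  have hb := binomPMF_nonneg (n - x) p hp0 hp1 k
  have hge : (x : ℝ) + k - K ≤ ((x + k - min (x + k) K : ℕ) : ℝ) := by
    have : x + k ≤ (x + k - min (x + k) K) + K := by omega
    have : ((x + k : ℕ) : ℝ) ≤ (((x + k - min (x + k) K) + K : ℕ) : ℝ) := by exact_mod_cast this
    rw [Nat.cast_add, Nat.cast_add _ K] at this
    linarith
  by_cases h : ((n : ℝ) - x) * (p - δ) < k
  · rw [if_pos h, if_pos (by linarith)]
  · rw [if_neg h]
    split_ifs
    · exact hb
    · exact le_rfl
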